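/- The function x ↦ (3x³ + 9i·x² + 21x − 5i)/((x − i)⁵·(x + i)³), viewed as a map from ℝ to ℂ, is integrable on ℝ, and its integral over ℝ equals 45πi/16. (This is the normal-direction integral evaluated by residues in equations (5.35) and (5.39), yielding the coefficient 45/2·dim F·π·h'(0)·Ω₄ in case (b) for the twisted signature operator.) -/

import Mathlib

open Complex MeasureTheory

open Filter Topology

lemma ofReal_sub_I_ne_zero (x : ℝ) : (x : ℂ) - I ≠ 0 := fun h => by
  simpa using congrArg Complex.im h

lemma ofReal_add_I_ne_zero (x : ℝ) : (x : ℂ) + I ≠ 0 := fun h => by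
  simpa using congrArg Complex.im h

lemma norm_ofReal_sub_I (x : ℝ) : ‖(x : ℂ) - I‖ = √(1 + x ^ 2) := by
  rw [Complex.norm_def, Complex.normSq_apply]
  congr 1
  simp
  ring

lemma norm_ofReal_add_I (x : ℝ) : ‖(x : ℂ) + I‖ = √(1 + x ^ 2) := by
  rw [Complex.norm_def, Complex.normSq_apply]
  congr 1
  simp
  ring

lemma norm_integrand_le (x : ℝ) :
    ‖(3 * (x : ℂ)^3 + 9 * I * (x : ℂ)^2 + 21 * (x : ℂ) - 5 * I) /
      (((x : ℂ) - I) ^ 5 * ((x : ℂ) + I) ^ 3)‖ ≤ 38 * (1 + x ^ 2)⁻¹ := by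
  rw [norm_div, norm_mul, norm_pow, norm_pow, norm_ofReal_sub_I, norm_ofReal_add_I]
  have hsq : √(1 + x ^ 2) ^ 2 = 1 + x ^ 2 := Real.sq_sqrt (by positivity)
  have hone : 1 ≤ √(1 + x ^ 2) := Real.one_le_sqrt.2 (by nlinarith [sq_nonneg x])
  have habs : |x| ≤ √(1 + x ^ 2) := Real.abs_le_sqrt (by linarith)
  rw [show 38 * (1 + x ^ 2)⁻¹ = 38 * (√(1 + x ^ 2) ^ 2)⁻¹ by rw [hsq]]
  generalize √(1 + x ^ 2) = r at *
  have hnum : ‖3 * (x : ℂ)^3 + 9 * I * (x : ℂ)^2 + 21 * (x : ℂ) - 5 * I‖ ≤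
      3 * |x| ^ 3 + 9 * |x| ^ 2 + 21 * |x| + 5 := by
    refine (norm_sub_le _ _).trans (add_le_add (norm_add₃_le.trans ?_) ?_) <;> simp
  have h3 : |x| ^ 3 ≤ r ^ 3 := by gcongr
  have h2 : |x| ^ 2 ≤ r ^ 3 :=
    (pow_le_pow_left₀ (abs_nonneg x) habs 2).trans (pow_le_pow_right₀ hone (by norm_num))
  have h1 : |x| ≤ r ^ 3 := habs.trans (le_self_pow₀ hone (by norm_num))
  have h0 : 1 ≤ r ^ 3 := one_le_pow₀ hone
  rw [← div_eq_mul_inv, div_le_div_iff₀ (by positivity) (by positivity)]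
  calc _ ≤ 38 * r ^ 3 * r ^ 2 := by gcongr; linarith
    _ = 38 * r ^ 5 := by ring
    _ ≤ 38 * (r ^ 5 * r ^ 3) := by
      gcongr
      exact le_mul_of_one_le_right (by positivity) h0

lemma integrable_integrand : Integrable (fun x : ℝ =>
    (3 * (x : ℂ)^3 + 9 * I * (x : ℂ)^2 + 21 * (x : ℂ) - 5 * I) /
      (((x : ℂ) - I) ^ 5 * ((x : ℂ) + I) ^ 3)) := by
  refine (integrable_inv_one_add_sq.const_mul 38).mono' ?_ (.of_forall norm_integrand_le)
  refine Continuous.aestronglyMeasurable (Continuous.div (by fun_prop) (by fun_prop) fun x => ?_)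
  exact mul_ne_zero (pow_ne_zero _ (ofReal_sub_I_ne_zero x)) (pow_ne_zero _ (ofReal_add_I_ne_zero x))

/-- The rational part of an antiderivative of the integrand, as a polynomial in
`u = (x - i)⁻¹` and `v = (x + i)⁻¹`. -/
noncomputable def antiderivRationalPart (u v : ℂ) : ℂ :=
  u ^ 4 / 8 + I / 2 * u ^ 3 + 3 / 16 * u ^ 2 + 5 * I / 4 * u + 25 * I / 16 * v - v ^ 2 / 2

lemma hasDerivAt_antideriv (x : ℝ) :
    HasDerivAt (fun x : ℝ => 45 * I / 16 * (Real.arctan x : ℂ) +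
      antiderivRationalPart ((x : ℂ) - I)⁻¹ ((x : ℂ) + I)⁻¹)
    ((3 * (x : ℂ)^3 + 9 * I * (x : ℂ)^2 + 21 * (x : ℂ) - 5 * I) /
      (((x : ℂ) - I) ^ 5 * ((x : ℂ) + I) ^ 3)) x := by
  have hm := ofReal_sub_I_ne_zero x
  have hp := ofReal_add_I_ne_zero x
  have hx : HasDerivAt (fun y : ℝ => (y : ℂ)) 1 x := (hasDerivAt_id x).ofReal_comp
  have hu := (hx.sub_const I).fun_inv hm
  have hv := (hx.add_const I).fun_inv hp
  have ha := (Real.hasDerivAt_arctan x).ofReal_comp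
  have hatan : ((1 / (1 + x ^ 2) : ℝ) : ℂ) = ((x : ℂ) - I)⁻¹ * ((x : ℂ) + I)⁻¹ := by
    rw [← mul_inv, one_div]
    push_cast
    congr 1
    linear_combination I_sq
  rw [hatan] at ha
  refine ((ha.const_mul (45 * I / 16)).add ((((((hu.fun_pow 4).div_const 8).add
    ((hu.fun_pow 3).const_mul (I / 2))).add ((hu.fun_pow 2).const_mul (3 / 16))).add
    (hu.const_mul (5 * I / 4))).add (hv.const_mul (25 * I / 16)) |>.sub
    ((hv.fun_pow 2).div_const 2))).congr_deriv ?_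
  obtain ⟨u, hxu⟩ : ∃ u, (x : ℂ) = u + I := ⟨x - I, by ring⟩
  rw [hxu] at hm hp ⊢
  have hu0 : u ≠ 0 := by simpa using hm
  have hv0 : u + 2 * I ≠ 0 := by convert hp using 1; ring
  rw [show u + I - I = u by ring, show u + I + I = u + 2 * I by ring]
  obtain ⟨v, hv⟩ : ∃ v, v = u + 2 * I := ⟨_, rfl⟩
  rw [← hv] at hv0 ⊢
  norm_num only [Nat.cast_ofNat]
  field_simp
  rw [hv]
  ring_nf
  simp only [I_sq, I_pow_three, I_pow_four]
  ring

lemma tendsto_antiderivRationalPart {l : Filter ℝ}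
    (hl : Tendsto (fun x : ℝ => √(1 + x ^ 2)) l atTop) :
    Tendsto (fun x : ℝ => antiderivRationalPart ((x : ℂ) - I)⁻¹ ((x : ℂ) + I)⁻¹) l (𝓝 0) := by
  have hu : Tendsto (fun x : ℝ => ((x : ℂ) - I)⁻¹) l (𝓝 0) := by
    rw [tendsto_zero_iff_norm_tendsto_zero]
    simp only [norm_inv, norm_ofReal_sub_I]
    exact tendsto_inv_atTop_zero.comp hl
  have hv : Tendsto (fun x : ℝ => ((x : ℂ) + I)⁻¹) l (𝓝 0) := by
    rw [tendsto_zero_iff_norm_tendsto_zero]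
    simp only [norm_inv, norm_ofReal_add_I]
    exact tendsto_inv_atTop_zero.comp hl
  have hc : Continuous fun p : ℂ × ℂ => antiderivRationalPart p.1 p.2 := by
    unfold antiderivRationalPart
    fun_prop
  have h := (hc.tendsto (0, 0)).comp (hu.prodMk_nhds hv)
  simpa [antiderivRationalPart, Function.comp_def] using h

lemma tendsto_antideriv {l : Filter ℝ} {a : ℝ} (habs : Tendsto (fun x : ℝ => |x|) l atTop)
    (ha : Tendsto Real.arctan l (𝓝 a)) :
    Tendsto (fun x : ℝ => 45 * I / 16 * (Real.arctan x : ℂ) +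
      antiderivRationalPart ((x : ℂ) - I)⁻¹ ((x : ℂ) + I)⁻¹) l (𝓝 (45 * I / 16 * (a : ℂ))) := by
  have hl : Tendsto (fun x : ℝ => √(1 + x ^ 2)) l atTop :=
    tendsto_atTop_mono (fun x => Real.abs_le_sqrt (by linarith)) habs
  have hc := (continuous_ofReal.tendsto a).comp ha
  simpa using (hc.const_mul (45 * I / 16)).add (tendsto_antiderivRationalPart hl)

theorem stmt_12 :
    MeasureTheory.Integrable
      (fun x : ℝ => (3 * (x : ℂ)^3 + 9 * I * (x : ℂ)^2 + 21 * (x : ℂ) - 5 * I) / (((x : ℂ) - I) ^ 5 * ((x : ℂ) + I) ^ 3)) ∧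
    ∫ x : ℝ, (3 * (x : ℂ)^3 + 9 * I * (x : ℂ)^2 + 21 * (x : ℂ) - 5 * I) / (((x : ℂ) - I) ^ 5 * ((x : ℂ) + I) ^ 3) = 45 * (Real.pi : ℂ) * I / 16 := by
  refine ⟨integrable_integrand, ?_⟩
  rw [integral_of_hasDerivAt_of_tendsto hasDerivAt_antideriv integrable_integrand
    (tendsto_antideriv tendsto_abs_atBot_atTop
      (Real.tendsto_arctan_atBot.mono_right nhdsWithin_le_nhds))
    (tendsto_antideriv tendsto_abs_atTop_atTop
      (Real.tendsto_arctan_atTop.mono_right nhdsWithin_le_nhds))]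
  push_cast
  ring
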